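/- The set V is a subgroup of the group of unit quaternions of order 120 (the binary dodecahedral group): every element of V has norm 1, 1 ∈ V, V is closed under quaternion multiplication, V is closed under quaternion conjugation (hence under inverses, since q̄ = q⁻¹ for unit quaternions), and V has exactly 120 elements. -/

import Mathlib

open Quaternion

noncomputable section

/-- The golden ratio. -/
def gold : ℝ := (1 + Real.sqrt 5) / 2

/-- The coordinates of a quaternion, viewed as a vector in `ℝ⁴`. -/
def qcoords (q : ℍ[ℝ]) : Fin 4 → ℝ := ![q.re, q.imI, q.imJ, q.imK]

/-- The standard inner product of two quaternions viewed as vectors in `ℝ⁴`. -/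
def qinner (p q : ℍ[ℝ]) : ℝ := ∑ i, qcoords p i * qcoords q i

/-- A choice of signs. -/
def IsSign (s : Fin 4 → ℝ) : Prop := ∀ i, s i = 1 ∨ s i = -1

/-- The coordinate multiset `(0, 1, φ⁻¹, φ)`. -/
def baseVec : Fin 4 → ℝ := ![0, 1, gold⁻¹, gold]

/-- The 120 facet centers of the right-angled 120-cell: the 24 Hurwitz units
`±1, ±i, ±j, ±k, (±1±i±j±k)/2` together with the 96 quaternions obtained from
`(0 ± i ± φ⁻¹j ± φk)/2` by even permutations of the coordinates `(0,1,φ⁻¹,φ)`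
and all choices of signs. -/
def Vcell : Set ℍ[ℝ] :=
  {q | (∃ s : Fin 4 → ℝ, IsSign s ∧
          ((∃ i : Fin 4, ∀ j, qcoords q j = if j = i then s i else 0) ∨
           (∀ j, qcoords q j = s j / 2))) ∨
       (∃ σ : Equiv.Perm (Fin 4), σ ∈ alternatingGroup (Fin 4) ∧
          ∃ s : Fin 4 → ℝ, IsSign s ∧ ∀ j, qcoords q j = s j * baseVec (σ j) / 2)}

/-- Facet adjacency in the 120-cell: two facet centers are adjacent iff their
inner product equals `φ/2 = cos (π/5)`. -/
def Adj (p q : ℍ[ℝ]) : Prop := p ∈ Vcell ∧ q ∈ Vcell ∧ qinner p q = gold / 2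

/-- A nonsingular coloring (characteristic function) of the 120-cell: facets get
nonzero colors in `(ℤ/2)⁴` and any four pairwise adjacent facets get a basis. -/
def Nonsingular (lam : ℍ[ℝ] → (Fin 4 → ZMod 2)) : Prop :=
  (∀ q ∈ Vcell, lam q ≠ 0) ∧
  ∀ a b c d : ℍ[ℝ], Adj a b → Adj a c → Adj a d → Adj b c → Adj b d → Adj c d →
    LinearIndependent (ZMod 2) ![lam a, lam b, lam c, lam d]

/-- The symmetry group of the 120-cell, realized as the permutations of `Vcell`
of the form `x ↦ pxq` or `x ↦ p x̄ q` with `p, q ∈ Vcell`. -/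
def SymE : Set (ℍ[ℝ] → ℍ[ℝ]) :=
  {f | ∃ p ∈ Vcell, ∃ q ∈ Vcell,
        (f = fun x => p * x * q) ∨ (f = fun x => p * star x * q)}

/-- DJ-equivalence of colorings: `λ = g ∘ μ ∘ a` on the facets, for some
`g ∈ GL₄(ℤ/2)` and some symmetry `a` of the 120-cell. -/
def DJEquiv (lam mu : ℍ[ℝ] → (Fin 4 → ZMod 2)) : Prop :=
  ∃ g : (Fin 4 → ZMod 2) ≃ₗ[ZMod 2] (Fin 4 → ZMod 2),
    ∃ a ∈ SymE, ∀ x ∈ Vcell, lam x = g (mu (a x))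

/-- Orientability (Nakayama–Nishimura): after a change of basis every color has
odd weight. -/
def OrientableColoring (lam : ℍ[ℝ] → (Fin 4 → ZMod 2)) : Prop :=
  ∃ g : (Fin 4 → ZMod 2) ≃ₗ[ZMod 2] (Fin 4 → ZMod 2),
    ∀ x ∈ Vcell, ∑ i, g (lam x) i = 1



/-! ### An exact integer model

The pair `(a, b)` stands for `a + b φ` in `ℤ[φ]`, and a quadruple of such pairs stands for
*twice* a quaternion. -/

/-- Pairs of integers, standing for `a + b φ`. -/
abbrev ZPhi := ℤ × ℤ

/-- Quadruples of elements of `ℤ[φ]`: doubled quaternions. -/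
abbrev ZQuat := ZPhi × ZPhi × ZPhi × ZPhi

def zmul (x y : ZPhi) : ZPhi := (x.1 * y.1 + x.2 * y.2, x.1 * y.2 + x.2 * y.1 + x.2 * y.2)
def zadd (x y : ZPhi) : ZPhi := (x.1 + y.1, x.2 + y.2)
def zsub (x y : ZPhi) : ZPhi := (x.1 - y.1, x.2 - y.2)
def zsmul (e : ℤ) (x : ZPhi) : ZPhi := (e * x.1, e * x.2)

def qmul (x y : ZQuat) : ZQuat :=
  (zsub (zsub (zsub (zmul x.1 y.1) (zmul x.2.1 y.2.1)) (zmul x.2.2.1 y.2.2.1))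
      (zmul x.2.2.2 y.2.2.2),
   zsub (zadd (zadd (zmul x.1 y.2.1) (zmul x.2.1 y.1)) (zmul x.2.2.1 y.2.2.2))
      (zmul x.2.2.2 y.2.2.1),
   zadd (zadd (zsub (zmul x.1 y.2.2.1) (zmul x.2.1 y.2.2.2)) (zmul x.2.2.1 y.1))
      (zmul x.2.2.2 y.2.1),
   zadd (zsub (zadd (zmul x.1 y.2.2.2) (zmul x.2.1 y.2.2.1)) (zmul x.2.2.1 y.2.1))
      (zmul x.2.2.2 y.1))

def qdbl (x : ZQuat) : ZQuat :=
  (zsmul 2 x.1, zsmul 2 x.2.1, zsmul 2 x.2.2.1, zsmul 2 x.2.2.2)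

def qconj (x : ZQuat) : ZQuat :=
  (x.1, zsmul (-1) x.2.1, zsmul (-1) x.2.2.1, zsmul (-1) x.2.2.2)

def qnsq (x : ZQuat) : ZPhi :=
  zadd (zadd (zadd (zmul x.1 x.1) (zmul x.2.1 x.2.1)) (zmul x.2.2.1 x.2.2.1))
    (zmul x.2.2.2 x.2.2.2)

def zeq (x y : ZPhi) : Bool := Int.beq' x.1 y.1 && Int.beq' x.2 y.2

def qeq (x y : ZQuat) : Bool :=
  zeq x.1 y.1 && (zeq x.2.1 y.2.1 && (zeq x.2.2.1 y.2.2.1 && zeq x.2.2.2 y.2.2.2))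

/-- The elements `± x` for `x` in `(0, 1, φ⁻¹, φ)`. -/
def pm : Fin 4 → List ZPhi :=
  ![[(0, 0)], [(1, 0), (-1, 0)], [(-1, 1), (1, -1)], [(0, 1), (0, -1)]]

/-- The even permutations of four letters, as lists of values. -/
def evens : List (Fin 4 × Fin 4 × Fin 4 × Fin 4) :=
  [(0, 1, 2, 3), (0, 2, 3, 1), (0, 3, 1, 2), (1, 0, 3, 2), (1, 2, 0, 3), (1, 3, 2, 0),
   (2, 0, 1, 3), (2, 1, 3, 0), (2, 3, 0, 1), (3, 0, 2, 1), (3, 1, 0, 2), (3, 2, 1, 0)]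

def fam (t : Fin 4 × Fin 4 × Fin 4 × Fin 4) : List ZQuat :=
  (pm t.1).flatMap fun a => (pm t.2.1).flatMap fun b => (pm t.2.2.1).flatMap fun c =>
    (pm t.2.2.2).map fun d => (a, b, c, d)

def unitL : List ZQuat :=
  [((2, 0), (0, 0), (0, 0), (0, 0)), ((0, 0), (2, 0), (0, 0), (0, 0)),
   ((0, 0), (0, 0), (2, 0), (0, 0)), ((0, 0), (0, 0), (0, 0), (2, 0)),
   ((-2, 0), (0, 0), (0, 0), (0, 0)), ((0, 0), (-2, 0), (0, 0), (0, 0)),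
   ((0, 0), (0, 0), (-2, 0), (0, 0)), ((0, 0), (0, 0), (0, 0), (-2, 0))]

def hurL : List ZQuat := unitL ++ fam (1, 1, 1, 1)

def allL : List ZQuat := hurL ++ evens.flatMap fam

def qOne : ZQuat := ((2, 0), (0, 0), (0, 0), (0, 0))

/-- Generators: `i`, `j`, a Hurwitz unit of order six and an icosian of order ten. -/
def genL : List ZQuat :=
  [((0, 0), (2, 0), (0, 0), (0, 0)), ((0, 0), (0, 0), (2, 0), (0, 0)),
   ((1, 0), (1, 0), (1, 0), (1, 0)), ((0, 1), (-1, 1), (1, 0), (0, 0))]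

/-- Some products of two generators. -/
def genL2 : List ZQuat :=
  qOne :: ((-2, 0), (0, 0), (0, 0), (0, 0)) :: ((0, 0), (0, 0), (0, 0), (2, 0)) ::
    ((-1, 0), (1, 0), (1, 0), (1, 0)) :: ((-1, 1), (1, 0), (0, 1), (0, 0)) :: genL

/-- Right coset representatives of the Hurwitz units modulo signs and the quaternion group. -/
def rotL : List ZQuat :=
  [qOne, ((1, 0), (1, 0), (1, 0), (1, 0)), ((-1, 0), (1, 0), (1, 0), (1, 0))]

/-- Right coset representatives of the Hurwitz units: powers of an element of order ten. -/
def cosL : List ZQuat :=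
  [qOne,
   ((0, 1), (-1, 1), (1, 0), (0, 0)),
   ((-1, 1), (1, 0), (0, 1), (0, 0)),
   ((1, -1), (1, 0), (0, 1), (0, 0)),
   ((0, -1), (-1, 1), (1, 0), (0, 0))]

/-- Every element of `B` is a product of an element of `A` and an element of `C`. -/
def factors (B A C : List ZQuat) : Bool :=
  B.all fun z => A.any fun u => C.any fun v => qeq (qdbl z) (qmul u v)

theorem gen2_check : factors genL2 (qOne :: genL) (qOne :: genL) = true := by decide +kernel
theorem unit_check : factors unitL genL2 genL2 = true := by decide +kernel
theorem cos_check : factors cosL genL2 genL2 = true := by decide +kernel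
theorem hur_check : factors hurL unitL rotL = true := by decide +kernel
theorem all_check : (allL.all fun z => cosL.any fun v => hurL.any fun u =>
    qeq (qdbl u) (qmul z (qconj v))) = true := by decide +kernel
theorem mul_check : (genL.all fun v => allL.all fun z => allL.any fun r =>
    qeq (qdbl r) (qmul z v)) = true := by decide +kernel
theorem conj_check : (allL.all fun z => allL.any fun r => qeq r (qconj z)) = true := by
  decide +kernel
theorem nsq_check : (allL.all fun z => zeq (qnsq z) (4, 0)) = true := by decide +kernel
theorem length_check : allL.length = 120 := by decide +kernel
theorem nodup_check : allL.Nodup := by decide +kernel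

theorem qeq_iff (x y : ZQuat) : qeq x y = true ↔ x = y := by
  obtain ⟨⟨a, b⟩, ⟨c, d⟩, ⟨e, f⟩, ⟨g, h⟩⟩ := x
  obtain ⟨⟨a', b'⟩, ⟨c', d'⟩, ⟨e', f'⟩, ⟨g', h'⟩⟩ := y
  simp [qeq, zeq, and_assoc]

theorem gold_sq : gold * gold = gold + 1 := by
  have h : Real.sqrt 5 * Real.sqrt 5 = 5 := Real.mul_self_sqrt (by norm_num)
  unfold gold
  nlinarith

theorem gold_inv : gold⁻¹ = gold - 1 := by
  have h := gold_sq
  have h0 : gold ≠ 0 := by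
    intro h0
    rw [h0] at h
    norm_num at h
  field_simp
  linarith

theorem gold_irrational : Irrational gold := by
  have : gold = Real.goldenRatio := rfl
  rw [this]
  exact Real.goldenRatio_irrational

/-- The real number `a + b φ`. -/
def toR (x : ZPhi) : ℝ := x.1 + x.2 * gold

/-- The quaternion half of a `ZQuat`. -/
def toQ (z : ZQuat) : ℍ[ℝ] :=
  ⟨toR z.1 / 2, toR z.2.1 / 2, toR z.2.2.1 / 2, toR z.2.2.2 / 2⟩

theorem toQ_re (z : ZQuat) : (toQ z).re = toR z.1 / 2 := rfl
theorem toQ_imI (z : ZQuat) : (toQ z).imI = toR z.2.1 / 2 := rfl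
theorem toQ_imJ (z : ZQuat) : (toQ z).imJ = toR z.2.2.1 / 2 := rfl
theorem toQ_imK (z : ZQuat) : (toQ z).imK = toR z.2.2.2 / 2 := rfl

theorem toR_inj {x y : ZPhi} (h : toR x = toR y) : x = y := by
  obtain ⟨a, b⟩ := x
  obtain ⟨c, d⟩ := y
  simp only [toR] at h
  by_cases hbd : b = d
  · subst hbd
    have : (a : ℝ) = c := by linarith
    rw [Int.cast_inj.mp this]
  · exfalso
    have hne : (b : ℝ) - d ≠ 0 := by
      intro h0
      exact hbd (by exact_mod_cast sub_eq_zero.mp h0)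
    apply gold_irrational
    refine ⟨((c - a : ℤ) : ℚ) / ((b - d : ℤ) : ℚ), ?_⟩
    push_cast
    rw [div_eq_iff hne]
    linarith

theorem toQ_inj : Function.Injective toQ := by
  rintro ⟨a, b, c, d⟩ ⟨a', b', c', d'⟩ h
  have h1 : toR a / 2 = toR a' / 2 := congrArg (fun q : ℍ[ℝ] => q.re) h
  have h2 : toR b / 2 = toR b' / 2 := congrArg (fun q : ℍ[ℝ] => q.imI) h
  have h3 : toR c / 2 = toR c' / 2 := congrArg (fun q : ℍ[ℝ] => q.imJ) h
  have h4 : toR d / 2 = toR d' / 2 := congrArg (fun q : ℍ[ℝ] => q.imK) h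
  rw [toR_inj (x := a) (y := a') (by linarith), toR_inj (x := b) (y := b') (by linarith),
    toR_inj (x := c) (y := c') (by linarith), toR_inj (x := d) (y := d') (by linarith)]

theorem toR_zmul (x y : ZPhi) : toR (zmul x y) = toR x * toR y := by
  simp only [toR, zmul]
  push_cast
  linear_combination (-(x.2 : ℝ) * y.2) * gold_sq

theorem toR_zadd (x y : ZPhi) : toR (zadd x y) = toR x + toR y := by
  simp only [toR, zadd]
  push_cast
  ring

theorem toR_zsub (x y : ZPhi) : toR (zsub x y) = toR x - toR y := by
  simp only [toR, zsub]
  push_cast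
  ring

theorem toR_zsmul (e : ℤ) (x : ZPhi) : toR (zsmul e x) = e * toR x := by
  simp only [toR, zsmul]
  push_cast
  ring

theorem toQ_mul {r x y : ZQuat} (h : qdbl r = qmul x y) : toQ r = toQ x * toQ y := by
  have h1 := congrArg (fun z : ZQuat => toR z.1) h
  have h2 := congrArg (fun z : ZQuat => toR z.2.1) h
  have h3 := congrArg (fun z : ZQuat => toR z.2.2.1) h
  have h4 := congrArg (fun z : ZQuat => toR z.2.2.2) h
  simp only [qdbl, qmul, toR_zsmul, toR_zadd, toR_zsub, toR_zmul] at h1 h2 h3 h4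
  push_cast at h1 h2 h3 h4
  ext
  · simp only [Quaternion.re_mul, toQ_re, toQ_imI, toQ_imJ, toQ_imK]
    linear_combination h1 / 4
  · simp only [Quaternion.imI_mul, toQ_re, toQ_imI, toQ_imJ, toQ_imK]
    linear_combination h2 / 4
  · simp only [Quaternion.imJ_mul, toQ_re, toQ_imI, toQ_imJ, toQ_imK]
    linear_combination h3 / 4
  · simp only [Quaternion.imK_mul, toQ_re, toQ_imI, toQ_imJ, toQ_imK]
    linear_combination h4 / 4

theorem toQ_conj (x : ZQuat) : toQ (qconj x) = star (toQ x) := by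
  ext <;> simp [toQ_re, toQ_imI, toQ_imJ, toQ_imK, qconj, toR_zsmul, neg_div]

theorem toQ_one : toQ qOne = 1 := by
  ext <;> simp [toQ, qOne, toR]

/-- The image of the integer list. -/
def modelV : Set ℍ[ℝ] := {q | ∃ z ∈ allL, toQ z = q}

theorem pm_iff (i : Fin 4) (x : ℝ) :
    (∃ e : ℝ, (e = 1 ∨ e = -1) ∧ x = e * baseVec i / 2) ↔ ∃ a ∈ pm i, x = toR a / 2 := by
  fin_cases i
  all_goals simp [pm, baseVec, toR, gold_inv]
  all_goals ring_nf

theorem mem_fam (t : Fin 4 × Fin 4 × Fin 4 × Fin 4) (q : ℍ[ℝ]) :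
    (∃ z ∈ fam t, toQ z = q) ↔ ∃ s : Fin 4 → ℝ, IsSign s ∧
      ∀ j, qcoords q j = s j * baseVec (![t.1, t.2.1, t.2.2.1, t.2.2.2] j) / 2 := by
  constructor
  · rintro ⟨z, hz, rfl⟩
    simp only [fam, List.mem_flatMap, List.mem_map] at hz
    obtain ⟨a, ha, b, hb, c, hc, d, hd, rfl⟩ := hz
    obtain ⟨e0, h0, k0⟩ := (pm_iff t.1 _).mpr ⟨a, ha, rfl⟩
    obtain ⟨e1, h1, k1⟩ := (pm_iff t.2.1 _).mpr ⟨b, hb, rfl⟩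
    obtain ⟨e2, h2, k2⟩ := (pm_iff t.2.2.1 _).mpr ⟨c, hc, rfl⟩
    obtain ⟨e3, h3, k3⟩ := (pm_iff t.2.2.2 _).mpr ⟨d, hd, rfl⟩
    refine ⟨![e0, e1, e2, e3], ?_, ?_⟩
    · intro i
      fin_cases i <;> assumption
    · intro j
      fin_cases j <;> assumption
  · rintro ⟨s, hs, h⟩
    obtain ⟨a, ha, ka⟩ := (pm_iff t.1 _).mp ⟨s 0, hs 0, h 0⟩
    obtain ⟨b, hb, kb⟩ := (pm_iff t.2.1 _).mp ⟨s 1, hs 1, h 1⟩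
    obtain ⟨c, hc, kc⟩ := (pm_iff t.2.2.1 _).mp ⟨s 2, hs 2, h 2⟩
    obtain ⟨d, hd, kd⟩ := (pm_iff t.2.2.2 _).mp ⟨s 3, hs 3, h 3⟩
    refine ⟨(a, b, c, d), ?_, ?_⟩
    · simp only [fam, List.mem_flatMap, List.mem_map]
      exact ⟨a, ha, b, hb, c, hc, d, hd, rfl⟩
    · ext
      · exact ka.symm
      · exact kb.symm
      · exact kc.symm
      · exact kd.symm

theorem mem_half (q : ℍ[ℝ]) :
    (∃ z ∈ fam (1, 1, 1, 1), toQ z = q) ↔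
      ∃ s : Fin 4 → ℝ, IsSign s ∧ ∀ j, qcoords q j = s j / 2 := by
  rw [mem_fam]
  have h : ∀ j : Fin 4, baseVec ((![1, 1, 1, 1] : Fin 4 → Fin 4) j) = 1 := by
    intro j
    fin_cases j <;> simp [baseVec]
  simp only [h, mul_one]

theorem qcoords_eq_iff (p q : ℍ[ℝ]) : (∀ j, qcoords p j = qcoords q j) ↔ p = q := by
  constructor
  · intro h
    ext
    · exact h 0
    · exact h 1
    · exact h 2
    · exact h 3
  · rintro rfl j
    rfl

theorem mem_unit (q : ℍ[ℝ]) :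
    (∃ z ∈ unitL, toQ z = q) ↔ ∃ s : Fin 4 → ℝ, IsSign s ∧
      ∃ i : Fin 4, ∀ j, qcoords q j = if j = i then s i else 0 := by
  constructor
  · rintro ⟨z, hz, rfl⟩
    have key : ∃ e : ℝ, (e = 1 ∨ e = -1) ∧
        ∃ i : Fin 4, ∀ j, qcoords (toQ z) j = if j = i then e else 0 := by
      simp only [unitL, List.mem_cons, List.not_mem_nil, or_false] at hz
      rcases hz with rfl | rfl | rfl | rfl | rfl | rfl | rfl | rfl
      · exact ⟨1, by simp, 0, by intro j; fin_cases j <;> simp [qcoords, toQ, toR]⟩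
      · exact ⟨1, by simp, 1, by intro j; fin_cases j <;> simp [qcoords, toQ, toR]⟩
      · exact ⟨1, by simp, 2, by intro j; fin_cases j <;> simp [qcoords, toQ, toR]⟩
      · exact ⟨1, by simp, 3, by intro j; fin_cases j <;> simp [qcoords, toQ, toR]⟩
      · exact ⟨-1, by simp, 0, by intro j; fin_cases j <;> simp [qcoords, toQ, toR]⟩
      · exact ⟨-1, by simp, 1, by intro j; fin_cases j <;> simp [qcoords, toQ, toR]⟩
      · exact ⟨-1, by simp, 2, by intro j; fin_cases j <;> simp [qcoords, toQ, toR]⟩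
      · exact ⟨-1, by simp, 3, by intro j; fin_cases j <;> simp [qcoords, toQ, toR]⟩
    obtain ⟨e, he, i, hi⟩ := key
    exact ⟨fun _ => e, fun _ => he, i, hi⟩
  · rintro ⟨s, hs, i, h⟩
    have key : ∀ e : ℝ, (e = 1 ∨ e = -1) → ∃ z ∈ unitL,
        ∀ j, qcoords (toQ z) j = if j = i then e else 0 := by
      rintro e (rfl | rfl)
      · refine ⟨unitL[i.val]'(by simp only [unitL, List.length_cons]; omega),
          List.getElem_mem _, ?_⟩
        intro j
        fin_cases i <;> fin_cases j <;> simp [unitL, qcoords, toQ, toR]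
      · refine ⟨unitL[i.val + 4]'(by simp only [unitL, List.length_cons]; omega),
          List.getElem_mem _, ?_⟩
        intro j
        fin_cases i <;> fin_cases j <;> simp [unitL, qcoords, toQ, toR]
    obtain ⟨z, hz, hz'⟩ := key (s i) (hs i)
    exact ⟨z, hz, (qcoords_eq_iff _ _).mp fun j => by rw [hz', h]⟩

theorem evens_of_perm : ∀ σ : Equiv.Perm (Fin 4), σ ∈ alternatingGroup (Fin 4) →
    (σ 0, σ 1, σ 2, σ 3) ∈ evens := by
  simp only [Equiv.Perm.mem_alternatingGroup]
  decide +kernel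

theorem perm_of_evens : ∀ t ∈ evens, ∃ σ : Equiv.Perm (Fin 4),
    σ ∈ alternatingGroup (Fin 4) ∧ t = (σ 0, σ 1, σ 2, σ 3) := by
  simp only [Equiv.Perm.mem_alternatingGroup]
  decide +kernel

theorem vec_perm (σ : Equiv.Perm (Fin 4)) (j : Fin 4) :
    (![σ 0, σ 1, σ 2, σ 3] : Fin 4 → Fin 4) j = σ j := by
  fin_cases j <;> rfl

theorem mem_gold (q : ℍ[ℝ]) :
    (∃ z ∈ evens.flatMap fam, toQ z = q) ↔
      ∃ σ : Equiv.Perm (Fin 4), σ ∈ alternatingGroup (Fin 4) ∧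
        ∃ s : Fin 4 → ℝ, IsSign s ∧ ∀ j, qcoords q j = s j * baseVec (σ j) / 2 := by
  constructor
  · rintro ⟨z, hz, hq⟩
    obtain ⟨t, ht, hz⟩ := List.mem_flatMap.mp hz
    obtain ⟨σ, hσ, rfl⟩ := perm_of_evens t ht
    have := (mem_fam _ q).mp ⟨z, hz, hq⟩
    simp only [vec_perm] at this
    exact ⟨σ, hσ, this⟩
  · rintro ⟨σ, hσ, h⟩
    have := (mem_fam (σ 0, σ 1, σ 2, σ 3) q).mpr (by simpa only [vec_perm] using h)
    obtain ⟨z, hz, hq⟩ := this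
    exact ⟨z, List.mem_flatMap.mpr ⟨_, evens_of_perm σ hσ, hz⟩, hq⟩

theorem Vcell_eq : Vcell = modelV := by
  ext q
  have h : q ∈ modelV ↔ ((∃ z ∈ unitL, toQ z = q) ∨ (∃ z ∈ fam (1, 1, 1, 1), toQ z = q)) ∨
      (∃ z ∈ evens.flatMap fam, toQ z = q) := by
    simp only [modelV, allL, hurL, List.mem_append, or_and_right, exists_or, Set.mem_ofPred_eq]
  rw [h, mem_unit, mem_half, mem_gold]
  simp only [Vcell, Set.mem_ofPred_eq, and_or_left, exists_or]

/-- Right multiplication by `p` preserves the model. -/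
def Good (p : ℍ[ℝ]) : Prop := ∀ q ∈ modelV, q * p ∈ modelV

theorem good_one : Good (toQ qOne) := by
  intro q hq
  rwa [toQ_one, mul_one]

theorem Good.mul {p p' : ℍ[ℝ]} (h : Good p) (h' : Good p') : Good (p * p') := by
  intro q hq
  rw [← mul_assoc]
  exact h' _ (h _ hq)

theorem good_gen : ∀ z ∈ genL, Good (toQ z) := by
  rintro v hv _ ⟨z, hz, rfl⟩
  have h := mul_check
  simp only [List.all_eq_true, List.any_eq_true, qeq_iff] at h
  obtain ⟨r, hr, h⟩ := h v hv z hz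
  exact ⟨r, hr, toQ_mul h⟩

theorem good_factors {B A C : List ZQuat} (h : factors B A C = true)
    (hA : ∀ z ∈ A, Good (toQ z)) (hC : ∀ z ∈ C, Good (toQ z)) : ∀ z ∈ B, Good (toQ z) := by
  intro z hz
  simp only [factors, List.all_eq_true, List.any_eq_true, qeq_iff] at h
  obtain ⟨u, hu, v, hv, h⟩ := h z hz
  rw [toQ_mul h]
  exact (hA u hu).mul (hC v hv)

theorem model_normSq : ∀ z ∈ allL, Quaternion.normSq (toQ z) = 1 := by
  intro z hz
  have h := nsq_check
  simp only [List.all_eq_true, zeq, Bool.and_eq_true, Int.beq'_eq] at h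
  have h' : qnsq z = (4, 0) := Prod.ext (h z hz).1 (h z hz).2
  have h1 := congrArg toR h'
  simp only [qnsq, toR_zadd, toR_zmul] at h1
  have h2 : toR (4, 0) = 4 := by simp [toR]
  rw [h2] at h1
  rw [Quaternion.normSq_def']
  simp only [toQ]
  linear_combination h1 / 4

theorem cos_sub : ∀ z ∈ cosL, Quaternion.normSq (toQ z) = 1 := by
  have h : (cosL.all fun z => allL.any fun r => qeq z r) = true := by decide +kernel
  simp only [List.all_eq_true, List.any_eq_true, qeq_iff] at h
  intro z hz
  obtain ⟨r, hr, rfl⟩ := h z hz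
  exact model_normSq _ hr

theorem good_all : ∀ z ∈ allL, Good (toQ z) := by
  have g1 : ∀ z ∈ qOne :: genL, Good (toQ z) := by
    intro z hz
    rcases List.mem_cons.mp hz with rfl | hz
    · exact good_one
    · exact good_gen z hz
  have g2 := good_factors gen2_check g1 g1
  have gu := good_factors unit_check g2 g2
  have gc := good_factors cos_check g2 g2
  have gr : ∀ z ∈ rotL, Good (toQ z) := by
    intro z hz
    apply g2
    simp only [rotL, List.mem_cons, List.not_mem_nil, or_false] at hz
    rcases hz with rfl | rfl | rfl <;> simp [genL2, genL]
  have gh := good_factors hur_check gu gr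
  intro z hz
  have h := all_check
  simp only [List.all_eq_true, List.any_eq_true, qeq_iff] at h
  obtain ⟨v, hv, u, hu, h⟩ := h z hz
  have h1 := toQ_mul h
  have h2 : toQ u * toQ v = toQ z := by
    rw [h1, toQ_conj, mul_assoc, Quaternion.star_mul_self, cos_sub v hv]
    simp
  rw [← h2]
  exact (gh u hu).mul (gc v hv)

/-- `Vcell` is the binary dodecahedral group: a 120-element subgroup of the unit
quaternions closed under multiplication and quaternion conjugation. -/
theorem binary_dodecahedral_group :
    (∀ q ∈ Vcell, ‖q‖ = 1) ∧
    (1 : ℍ[ℝ]) ∈ Vcell ∧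
    (∀ p ∈ Vcell, ∀ q ∈ Vcell, p * q ∈ Vcell) ∧
    (∀ q ∈ Vcell, star q ∈ Vcell) ∧
    Set.ncard Vcell = 120 := by
  rw [Vcell_eq]
  refine ⟨?_, ⟨qOne, ?_, toQ_one⟩, ?_, ?_, ?_⟩
  · rintro _ ⟨z, hz, rfl⟩
    have h := model_normSq z hz
    rw [Quaternion.normSq_eq_norm_mul_self] at h
    nlinarith [norm_nonneg (toQ z)]
  · simp [allL, hurL, unitL, qOne]
  · rintro p hp _ ⟨z, hz, rfl⟩
    exact good_all z hz p hp
  · rintro _ ⟨z, hz, rfl⟩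
    have h := conj_check
    simp only [List.all_eq_true, List.any_eq_true, qeq_iff] at h
    obtain ⟨r, hr, rfl⟩ := h z hz
    exact ⟨_, hr, toQ_conj z⟩
  · have h : modelV = toQ '' (allL.toFinset : Set ZQuat) := by
      ext q
      simp [modelV]
    rw [h, Set.ncard_image_of_injective _ toQ_inj, Set.ncard_coe_finset,
      List.toFinset_card_of_nodup nodup_check, length_check]
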